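/- arXiv:2211.03869 — 3 statements merged into one kernel-verified Lean document; each statement's English description precedes it below -/
import Mathlib

section
/- (À la Gronwall lemma.) Let f: [0,T] → ℝ_+ be Borel, locally bounded and non-decreasing, and let ψ: [0,T] → ℝ_+ be non-negative and non-decreasing. If there exist constants A, B > 0 such that for all t ∈ [0,T], f(t) ≤ A ∫_0^t f(s) ds + B (∫_0^t f(s)^2 ds)^{1/2} + ψ(t), then for every t ∈ [0,T], f(t) ≤ 2 e^{(2A+B^2)t} ψ(t). -/
open MeasureTheory Set Filter Topology

/-- "À la Gronwall" lemma: if `f : [0,T] → ℝ₊` is Borel, (locally) bounded and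
non-decreasing, `ψ : [0,T] → ℝ₊` is non-negative and non-decreasing, and
`f(t) ≤ A ∫_0^t f(s) ds + B (∫_0^t f(s)² ds)^{1/2} + ψ(t)` for all `t ∈ [0,T]`
with constants `A, B > 0`, then `f(t) ≤ 2 e^{(2A+B²)t} ψ(t)` for every `t ∈ [0,T]`. -/
theorem gronwall_a_la
    (T A B : ℝ) (hT : 0 < T) (hA : 0 < A) (hB : 0 < B)
    (f ψ : ℝ → ℝ)
    (hf_meas : Measurable f)
    (hf_nonneg : ∀ t ∈ Set.Icc (0:ℝ) T, 0 ≤ f t)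
    (hf_bdd : BddAbove (f '' Set.Icc (0:ℝ) T))
    (hf_mono : MonotoneOn f (Set.Icc (0:ℝ) T))
    (hψ_nonneg : ∀ t ∈ Set.Icc (0:ℝ) T, 0 ≤ ψ t)
    (hψ_mono : MonotoneOn ψ (Set.Icc (0:ℝ) T))
    (h : ∀ t ∈ Set.Icc (0:ℝ) T,
      f t ≤ A * (∫ s in (0:ℝ)..t, f s) + B * Real.sqrt (∫ s in (0:ℝ)..t, f s ^ 2) + ψ t) :
    ∀ t ∈ Set.Icc (0:ℝ) T, f t ≤ 2 * Real.exp ((2 * A + B ^ 2) * t) * ψ t := by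
  intro t ht
  have hint : ∀ s ∈ Set.Icc (0:ℝ) T, IntervalIntegrable f volume 0 s := by
    intro s hs
    apply MonotoneOn.intervalIntegrable
    rw [Set.uIcc_of_le hs.1]
    exact hf_mono.mono (Set.Icc_subset_Icc le_rfl hs.2)
  -- linear inequality
  have hlin : ∀ s ∈ Set.Icc (0:ℝ) T,
      f s ≤ (2 * A + B ^ 2) * (∫ u in (0:ℝ)..s, f u) + 2 * ψ s := by
    intro s hs
    have h1 := h s hs
    have hfs := hf_nonneg s hs
    have hI0 : 0 ≤ ∫ u in (0:ℝ)..s, f u :=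
      intervalIntegral.integral_nonneg hs.1
        (fun u hu => hf_nonneg u ⟨hu.1, hu.2.trans hs.2⟩)
    have hmono2 : MonotoneOn (fun u => f u ^ 2) (Set.Icc (0:ℝ) s) := by
      intro a ha b hb hab
      have ha' : a ∈ Set.Icc (0:ℝ) T := ⟨ha.1, ha.2.trans hs.2⟩
      have hb' : b ∈ Set.Icc (0:ℝ) T := ⟨hb.1, hb.2.trans hs.2⟩
      exact pow_le_pow_left₀ (hf_nonneg a ha') (hf_mono ha' hb' hab) 2
    have hsq : (∫ u in (0:ℝ)..s, f u ^ 2) ≤ f s * ∫ u in (0:ℝ)..s, f u := by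
      rw [← intervalIntegral.integral_const_mul]
      apply intervalIntegral.integral_mono_on hs.1
      · apply MonotoneOn.intervalIntegrable
        rw [Set.uIcc_of_le hs.1]
        exact hmono2
      · exact (hint s hs).const_mul _
      · intro u hu
        have hu' : u ∈ Set.Icc (0:ℝ) T := ⟨hu.1, hu.2.trans hs.2⟩
        have := hf_mono hu' hs hu.2
        have := hf_nonneg u hu'
        nlinarith
    set I := ∫ u in (0:ℝ)..s, f u with hI
    have hroot : B * Real.sqrt (∫ u in (0:ℝ)..s, f u ^ 2) ≤ f s / 2 + B ^ 2 / 2 * I := by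
      have h2 : Real.sqrt (∫ u in (0:ℝ)..s, f u ^ 2) ≤ Real.sqrt (f s) * Real.sqrt I := by
        rw [← Real.sqrt_mul hfs]
        exact Real.sqrt_le_sqrt hsq
      have h3 := mul_le_mul_of_nonneg_left h2 hB.le
      have h4 := Real.sq_sqrt hfs
      have h5 := Real.sq_sqrt hI0
      nlinarith [sq_nonneg (Real.sqrt (f s) - B * Real.sqrt I)]
    linarith
  set K := 2 * A + B ^ 2 with hK
  have hK0 : 0 < K := by positivity
  set C := 2 * ψ t with hC
  have hC0 : 0 ≤ C := by have := hψ_nonneg t ht; positivity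
  set g : ℝ → ℝ := (Set.Icc (0:ℝ) t).indicator f with hg
  have hg_int : Integrable g := by
    rw [hg, integrable_indicator_iff measurableSet_Icc]
    have := (hint t ht)
    rw [intervalIntegrable_iff_integrableOn_Icc_of_le ht.1] at this
    exact this
  have hgf : ∀ s ∈ Set.Icc (0:ℝ) t, (∫ u in (0:ℝ)..s, f u) = ∫ u in (0:ℝ)..s, g u := by
    intro s hs
    apply intervalIntegral.integral_congr
    intro u hu
    rw [Set.uIcc_of_le hs.1] at hu
    have : u ∈ Set.Icc (0:ℝ) t := ⟨hu.1, hu.2.trans hs.2⟩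
    simp [hg, this.1, this.2]
  set G : ℝ → ℝ := fun s => C + K * ∫ u in (0:ℝ)..s, g u with hG
  have hGcont : Continuous G := by
    have := intervalIntegral.continuous_primitive (fun a b => hg_int.intervalIntegrable) (0:ℝ)
    exact continuous_const.add (continuous_const.mul this)
  have hfG : ∀ s ∈ Set.Icc (0:ℝ) t, f s ≤ G s := by
    intro s hs
    have hs' : s ∈ Set.Icc (0:ℝ) T := ⟨hs.1, hs.2.trans ht.2⟩
    have h1 := hlin s hs'
    have h2 := hψ_mono hs' ht hs.2
    rw [hgf s hs] at h1
    simp only [hG, hC]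
    linarith
  set H : ℝ → ℝ := fun s => C + K * ∫ u in (0:ℝ)..s, G u with hH
  have hGH : ∀ s ∈ Set.Icc (0:ℝ) t, G s ≤ H s := by
    intro s hs
    have hs' : s ∈ Set.Icc (0:ℝ) T := ⟨hs.1, hs.2.trans ht.2⟩
    simp only [hG, hH]
    rw [← hgf s hs]
    have : (∫ u in (0:ℝ)..s, f u) ≤ ∫ u in (0:ℝ)..s, G u := by
      apply intervalIntegral.integral_mono_on hs.1 (hint s hs') (hGcont.intervalIntegrable _ _)
      intro u hu
      exact hfG u ⟨hu.1, hu.2.trans hs.2⟩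
    have := mul_le_mul_of_nonneg_left this hK0.le
    linarith
  have hHd : ∀ s, HasDerivAt H (K * G s) s := by
    intro s
    have := (intervalIntegral.integral_hasDerivAt_right (hGcont.intervalIntegrable 0 s)
      (hGcont.stronglyMeasurableAtFilter _ _) hGcont.continuousAt)
    exact (this.const_mul K).const_add C
  have hEd : ∀ s, HasDerivAt (fun s => H s * Real.exp (-K * s))
      (K * G s * Real.exp (-K * s) + H s * (Real.exp (-K * s) * (-K))) s := by
    intro s
    have h1 : HasDerivAt (fun s : ℝ => -K * s) (-K) s := by
      simpa using (hasDerivAt_id s).const_mul (-K)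
    exact (hHd s).mul h1.exp
  have hanti : AntitoneOn (fun s => H s * Real.exp (-K * s)) (Set.Icc (0:ℝ) t) := by
    apply antitoneOn_of_deriv_nonpos (convex_Icc _ _)
    · exact fun s _ => (hEd s).continuousAt.continuousWithinAt
    · exact fun s _ => (hEd s).differentiableAt.differentiableWithinAt
    · intro s hs
      rw [(hEd s).deriv]
      have h1 := hGH s (interior_subset hs)
      have h2 := mul_nonneg (mul_nonneg hK0.le (Real.exp_pos (-K * s)).le) (sub_nonneg.2 h1)
      nlinarith
  have hfin := hanti (Set.left_mem_Icc.2 ht.1) (Set.right_mem_Icc.2 ht.1) ht.1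
  have hH0 : H 0 = C := by simp [hH]
  simp only [hH0, mul_zero, Real.exp_zero, mul_one] at hfin
  have htt : t ∈ Set.Icc (0:ℝ) t := Set.right_mem_Icc.2 ht.1
  have h1 := (hfG t htt).trans (hGH t htt)
  have h2 : H t ≤ C * Real.exp (K * t) := by
    have h3 := mul_le_mul_of_nonneg_right hfin (Real.exp_pos (K * t)).le
    have h4 : Real.exp (-K * t) * Real.exp (K * t) = 1 := by
      rw [← Real.exp_add]; simp
    rwa [mul_assoc, h4, mul_one] at h3
  calc f t ≤ C * Real.exp (K * t) := h1.trans h2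
    _ = 2 * Real.exp (K * t) * ψ t := by rw [hC]; ring
end

section
/- Let p ≥ 1 and μ, ν ∈ P_p(ℝ^d). For λ ∈ [0,1] let τ(λ) := λμ + (1−λ)ν denote the mixture measure (defined by (λμ+(1−λ)ν)(B) = λμ(B)+(1−λ)ν(B) for Borel B). Then τ(λ) ∈ P_p(ℝ^d) for every λ, and for all λ_1, λ_2 ∈ [0,1], W_p(τ(λ_1), τ(λ_2)) ≤ |λ_1 − λ_2|^{1/p} W_p(μ, ν); in particular λ ↦ τ(λ) is (1/p)-Hölder continuous with respect to W_p. -/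
open MeasureTheory Set Filter Topology

noncomputable section

/-- `Euc d` is the Euclidean space `ℝ^d`. -/
abbrev Euc (d : ℕ) : Type := EuclideanSpace ℝ (Fin d)

/-- The Wasserstein distance of order `p`:
`W_p(μ,ν) = inf_{π ∈ Π(μ,ν)} ( ∫ |x-y|^p dπ )^{1/p}`. -/
noncomputable def Wp {α : Type*} [MeasurableSpace α] [PseudoMetricSpace α]
    (p : ℝ) (μ ν : Measure α) : ℝ :=
  sInf ((fun π : Measure (α × α) => (∫ z, dist z.1 z.2 ^ p ∂π) ^ (1 / p)) ''
    {π | π.map Prod.fst = μ ∧ π.map Prod.snd = ν})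

/-- The mixture `λ μ + (1-λ) ν` of two measures. -/
noncomputable def mix {d : ℕ} (lam : ℝ) (μ ν : Measure (Euc d)) : Measure (Euc d) :=
  ENNReal.ofReal lam • μ + ENNReal.ofReal (1 - lam) • ν

lemma Wp_symm_aux {d : ℕ} (p : ℝ) (μ ν : Measure (Euc d)) : Wp p μ ν = Wp p ν μ := by
  have key : ∀ μ ν : Measure (Euc d),
      ((fun π : Measure (Euc d × Euc d) => (∫ z, dist z.1 z.2 ^ p ∂π) ^ (1 / p)) ''
        {π | π.map Prod.fst = μ ∧ π.map Prod.snd = ν}) ⊆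
      ((fun π : Measure (Euc d × Euc d) => (∫ z, dist z.1 z.2 ^ p ∂π) ^ (1 / p)) ''
        {π | π.map Prod.fst = ν ∧ π.map Prod.snd = μ}) := by
    rintro μ ν _ ⟨π, ⟨h1, h2⟩, rfl⟩
    refine ⟨π.map Prod.swap, ⟨?_, ?_⟩, ?_⟩
    · rw [Measure.map_map measurable_fst measurable_swap]; exact h2
    · rw [Measure.map_map measurable_snd measurable_swap]; exact h1
    · have hs : ∫ z, dist z.1 z.2 ^ p ∂(π.map Prod.swap) = ∫ z, dist z.1 z.2 ^ p ∂π := by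
        rw [integral_map measurable_swap.aemeasurable
          (Measurable.aestronglyMeasurable (by fun_prop))]
        exact integral_congr_ae (ae_of_all _ fun z => by simp [dist_comm])
      simp only [hs]
  unfold Wp
  rw [(key μ ν).antisymm (key ν μ)]

lemma Wp_shift_aux {d : ℕ} (p : ℝ) (hp : 1 ≤ p) (D μ ν : Measure (Euc d))
    [IsProbabilityMeasure μ] [IsProbabilityMeasure ν] (c : ℝ) (hc : 0 ≤ c) :
    Wp p (D + ENNReal.ofReal c • μ) (D + ENNReal.ofReal c • ν) ≤ c ^ (1 / p) * Wp p μ ν := by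
  have hp0 : p ≠ 0 := by linarith
  have hcp : 0 ≤ c ^ (1 / p) := Real.rpow_nonneg hc _
  have key : ∀ π : Measure (Euc d × Euc d), π.map Prod.fst = μ → π.map Prod.snd = ν →
      Wp p (D + ENNReal.ofReal c • μ) (D + ENNReal.ofReal c • ν) ≤
        c ^ (1 / p) * (∫ z, dist z.1 z.2 ^ p ∂π) ^ (1 / p) := by
    intro π h1 h2
    have hdm : Measurable (fun x : Euc d => (x, x)) := measurable_id.prodMk measurable_id
    have hfm : Measurable (fun z : Euc d × Euc d => dist z.1 z.2 ^ p) := by fun_prop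
    have hI : 0 ≤ ∫ z, dist z.1 z.2 ^ p ∂π := integral_nonneg fun z => by positivity
    have hDi : Integrable (fun z : Euc d × Euc d => dist z.1 z.2 ^ p)
        (D.map (fun x : Euc d => (x, x))) := by
      rw [integrable_map_measure hfm.aestronglyMeasurable hdm.aemeasurable]
      simp [Function.comp_def, Real.zero_rpow hp0]
    have hD0 : ∫ z, dist z.1 z.2 ^ p ∂(D.map (fun x : Euc d => (x, x))) = 0 := by
      rw [integral_map hdm.aemeasurable hfm.aestronglyMeasurable]
      simp [Real.zero_rpow hp0]
    have hint : ∫ z, dist z.1 z.2 ^ p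
        ∂(D.map (fun x : Euc d => (x, x)) + ENNReal.ofReal c • π) =
        c * ∫ z, dist z.1 z.2 ^ p ∂π := by
      by_cases hi : Integrable (fun z : Euc d × Euc d => dist z.1 z.2 ^ p) π
      · rw [integral_add_measure hDi (hi.smul_measure ENNReal.ofReal_ne_top), hD0,
          integral_smul_measure, ENNReal.toReal_ofReal hc]
        simp
      · rcases hc.eq_or_lt with rfl | hc'
        · simp [hD0]
        · rw [integral_undef hi, mul_zero]
          apply integral_undef
          intro h
          apply hi
          have := (integrable_add_measure.1 h).2
          exact (integrable_smul_measure (by simpa using hc') ENNReal.ofReal_ne_top).1 this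
    rw [← Real.mul_rpow hc hI, ← hint]
    refine csInf_le ⟨0, ?_⟩ ⟨_, ⟨?_, ?_⟩, rfl⟩
    · rintro _ ⟨ρ, -, rfl⟩
      exact Real.rpow_nonneg (integral_nonneg fun z => by positivity) _
    · rw [Measure.map_add _ _ measurable_fst, Measure.map_smul,
        Measure.map_map measurable_fst hdm, h1]
      congr 1
      exact Measure.map_id
    · rw [Measure.map_add _ _ measurable_snd, Measure.map_smul,
        Measure.map_map measurable_snd hdm, h2]
      congr 1
      exact Measure.map_id
  have hprod1 : (μ.prod ν).map Prod.fst = μ := by simp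
  have hprod2 : (μ.prod ν).map Prod.snd = ν := by simp
  rcases hcp.eq_or_lt with h0 | h0
  · have := key _ hprod1 hprod2
    rw [← h0] at this ⊢
    simpa using this
  · rw [mul_comm, ← div_le_iff₀ h0]
    refine le_csInf ⟨_, μ.prod ν, ⟨hprod1, hprod2⟩, rfl⟩ ?_
    rintro _ ⟨π, ⟨h1, h2⟩, rfl⟩
    rw [div_le_iff₀ h0, mul_comm]
    exact key π h1 h2

/-- For `μ, ν ∈ P_p(ℝ^d)` and `λ ∈ [0,1]`, the mixture `τ(λ) = λμ + (1-λ)ν` belongs to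
`P_p(ℝ^d)`, and `W_p(τ(λ₁),τ(λ₂)) ≤ |λ₁-λ₂|^{1/p} W_p(μ,ν)` for all `λ₁, λ₂ ∈ [0,1]`;
in particular `λ ↦ τ(λ)` is `(1/p)`-Hölder continuous for `W_p`. -/
theorem mixture_in_Pp_and_holder
    (d : ℕ) (hd : 0 < d) (p : ℝ) (hp : 1 ≤ p)
    (μ ν : Measure (Euc d)) [IsProbabilityMeasure μ] [IsProbabilityMeasure ν]
    (hμ : ∫⁻ x, ENNReal.ofReal (‖x‖ ^ p) ∂μ < ⊤)
    (hν : ∫⁻ x, ENNReal.ofReal (‖x‖ ^ p) ∂ν < ⊤) :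
    (∀ lam ∈ Set.Icc (0:ℝ) 1, IsProbabilityMeasure (mix lam μ ν) ∧
      ∫⁻ x, ENNReal.ofReal (‖x‖ ^ p) ∂(mix lam μ ν) < ⊤) ∧
    (∀ lam₁ ∈ Set.Icc (0:ℝ) 1, ∀ lam₂ ∈ Set.Icc (0:ℝ) 1,
      Wp p (mix lam₁ μ ν) (mix lam₂ μ ν) ≤ |lam₁ - lam₂| ^ (1 / p) * Wp p μ ν) := by
  refine ⟨?_, ?_⟩
  · rintro l ⟨h0, h1⟩
    refine ⟨⟨?_⟩, ?_⟩
    · simp only [mix, Measure.add_apply, Measure.smul_apply, measure_univ, smul_eq_mul, mul_one]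
      rw [← ENNReal.ofReal_add h0 (by linarith)]
      simp
    · simp only [mix, lintegral_add_measure, lintegral_smul_measure, smul_eq_mul]
      exact ENNReal.add_lt_top.2 ⟨ENNReal.mul_lt_top ENNReal.ofReal_lt_top hμ,
        ENNReal.mul_lt_top ENNReal.ofReal_lt_top hν⟩
  · have hA : ∀ a b : ℝ, 0 ≤ b → b ≤ a → a ≤ 1 → mix a μ ν =
        (ENNReal.ofReal b • μ + ENNReal.ofReal (1 - a) • ν) + ENNReal.ofReal (a - b) • μ := by
      intro a b hb hab ha
      have : ENNReal.ofReal a = ENNReal.ofReal b + ENNReal.ofReal (a - b) := by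
        rw [← ENNReal.ofReal_add hb (by linarith)]; congr 1; ring
      rw [mix, this, add_smul]; abel
    have hB : ∀ a b : ℝ, 0 ≤ b → b ≤ a → a ≤ 1 → mix b μ ν =
        (ENNReal.ofReal b • μ + ENNReal.ofReal (1 - a) • ν) + ENNReal.ofReal (a - b) • ν := by
      intro a b hb hab ha
      have : ENNReal.ofReal (1 - b) = ENNReal.ofReal (1 - a) + ENNReal.ofReal (a - b) := by
        rw [← ENNReal.ofReal_add (by linarith) (by linarith)]; congr 1; ring
      rw [mix, this, add_smul]; abel
    rintro a ⟨ha0, ha1⟩ b ⟨hb0, hb1⟩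
    rcases le_total b a with h | h
    · rw [hA a b hb0 h ha1, hB a b hb0 h ha1, abs_of_nonneg (by linarith)]
      exact Wp_shift_aux p hp _ μ ν _ (by linarith)
    · rw [hA b a ha0 h hb1, hB b a ha0 h hb1, abs_sub_comm, abs_of_nonneg (by linarith),
        Wp_symm_aux p μ ν]
      exact Wp_shift_aux p hp _ ν μ _ (by linarith)
end
end

section
/- Let T, λ, χ, C > 0 and p ≥ 1. Let K: [0,T] × ℝ² → ℝ² be a measurable kernel family with K_t(0) = 0 and |K_t(x) − K_t(y)| ≤ C|x−y| for all t ∈ [0,T], x, y ∈ ℝ². Define the path-dependent drift A(t, x, (μ_s)_{s∈[0,T]}) := χ ∫_0^t e^{-λ(t−s)} ( ∫_{ℝ²} K_{t−s}(x−y) μ_s(dy) ) ds. Then for all t ∈ [0,T], x_1, x_2 ∈ ℝ², and (μ_s), (ν_s) ∈ C([0,T],P_p(ℝ²)): |A(t,x_1,(μ_s)) − A(t,x_2,(ν_s))| ≤ (χ C / λ) ( |x_1 − x_2| + sup_{s∈[0,T]} W_p(μ_s, ν_s) ). -/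
open MeasureTheory Set Filter Topology

noncomputable section

/-- A family `(μ_t)` indexed by `ℝ` which, on `[0,T]`, is a curve in `C([0,T],P_p(ℝ²))`:
probability measures with finite `p`-th moment, continuous in time for `W_p`. -/
def IsPCurveOn (p T : ℝ) (μ : ℝ → Measure (Euc 2)) : Prop :=
  (∀ t ∈ Set.Icc (0:ℝ) T, IsProbabilityMeasure (μ t)) ∧
  (∀ t ∈ Set.Icc (0:ℝ) T, ∫⁻ x, ENNReal.ofReal (‖x‖ ^ p) ∂(μ t) < ⊤) ∧
  (∀ t ∈ Set.Icc (0:ℝ) T, ∀ ε > 0, ∃ δ > 0, ∀ s ∈ Set.Icc (0:ℝ) T,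
    |s - t| < δ → Wp p (μ s) (μ t) < ε)

/-- The path-dependent Keller–Segel drift
`A(t,x,(μ_s)) = χ ∫_0^t e^{-λ(t-s)} ( ∫_{ℝ²} K_{t-s}(x-y) μ_s(dy) ) ds`. -/
noncomputable def KSdrift (χ lam : ℝ) (K : ℝ → Euc 2 → Euc 2)
    (t : ℝ) (x : Euc 2) (μ : ℝ → Measure (Euc 2)) : Euc 2 :=
  ∫ s in (0:ℝ)..t, (χ * Real.exp (-lam * (t - s))) • (∫ y, K (t - s) (x - y) ∂(μ s))

/-- the `L^p` size of a measure -/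
def momNorm (p : ℝ) (μ : Measure (Euc 2)) : ℝ :=
  (eLpNorm (fun x : Euc 2 => x) (ENNReal.ofReal p) μ).toReal

lemma memLp_of_mom {p : ℝ} (hp : 1 ≤ p) {μ : Measure (Euc 2)}
    (h : ∫⁻ x, ENNReal.ofReal (‖x‖ ^ p) ∂μ < ⊤) :
    MemLp (fun x : Euc 2 => x) (ENNReal.ofReal p) μ := by
  refine ⟨by fun_prop, ?_⟩
  rw [eLpNorm_lt_top_iff_lintegral_rpow_enorm_lt_top (by simp; linarith) (by simp)]
  convert h using 3 with x
  rw [ENNReal.toReal_ofReal (by linarith), ← ofReal_norm,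
    ENNReal.ofReal_rpow_of_nonneg (norm_nonneg _) (by linarith)]

structure Cpl (p : ℝ) (μ ν : Measure (Euc 2)) (π : Measure (Euc 2 × Euc 2)) : Prop where
  prob : IsProbabilityMeasure π
  f : MemLp (fun z : Euc 2 × Euc 2 => z.1) (ENNReal.ofReal p) π
  s : MemLp (fun z : Euc 2 × Euc 2 => z.2) (ENNReal.ofReal p) π
  nf : eLpNorm (fun z : Euc 2 × Euc 2 => z.1) (ENNReal.ofReal p) π
    = eLpNorm (fun x : Euc 2 => x) (ENNReal.ofReal p) μ
  ns : eLpNorm (fun z : Euc 2 × Euc 2 => z.2) (ENNReal.ofReal p) π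
    = eLpNorm (fun x : Euc 2 => x) (ENNReal.ofReal p) ν
  cost : (∫ z, dist z.1 z.2 ^ p ∂π) ^ (1 / p) =
    (eLpNorm (fun z : Euc 2 × Euc 2 => z.1 - z.2) (ENNReal.ofReal p) π).toReal

lemma cpl_of {p : ℝ} (hp : 1 ≤ p) {μ ν : Measure (Euc 2)} [IsProbabilityMeasure μ]
    (hμ : MemLp (fun x : Euc 2 => x) (ENNReal.ofReal p) μ)
    (hν : MemLp (fun x : Euc 2 => x) (ENNReal.ofReal p) ν)
    {π : Measure (Euc 2 × Euc 2)} (h1 : π.map Prod.fst = μ) (h2 : π.map Prod.snd = ν) :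
    Cpl p μ ν π := by
  have P1 : MeasurePreserving Prod.fst π μ := ⟨measurable_fst, h1⟩
  have P2 : MeasurePreserving Prod.snd π ν := ⟨measurable_snd, h2⟩
  have f := hμ.comp_measurePreserving P1
  have s := hν.comp_measurePreserving P2
  refine ⟨?_, f, s, ?_, ?_, ?_⟩
  · have : IsProbabilityMeasure (π.map Prod.fst) := by rw [h1]; infer_instance
    exact ⟨by rw [← measure_univ (μ := π.map Prod.fst), Measure.map_apply measurable_fst .univ]; simp⟩
  · exact eLpNorm_comp_measurePreserving hμ.1 P1
  · exact eLpNorm_comp_measurePreserving hν.1 P2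
  · have h := (f.sub s).eLpNorm_eq_integral_rpow_norm (by simp; linarith) (by simp)
    have h' : (fun z : Euc 2 × Euc 2 => z.1 - z.2) =
      ((fun x : Euc 2 => x) ∘ Prod.fst - (fun x : Euc 2 => x) ∘ Prod.snd) := rfl
    rw [h', h, ENNReal.toReal_ofReal (by positivity), ENNReal.toReal_ofReal (by linarith)]
    simp [dist_eq_norm]

lemma le_Wp {p : ℝ} {μ ν : Measure (Euc 2)} [IsProbabilityMeasure μ] [IsProbabilityMeasure ν]
    {c : ℝ} (h : ∀ π : Measure (Euc 2 × Euc 2), π.map Prod.fst = μ → π.map Prod.snd = ν →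
      c ≤ (∫ z, dist z.1 z.2 ^ p ∂π) ^ (1 / p)) : c ≤ Wp p μ ν := by
  refine le_csInf (Set.Nonempty.image _ ⟨μ.prod ν, by simp, by simp⟩) ?_
  rintro _ ⟨π, ⟨h1, h2⟩, rfl⟩
  exact h π h1 h2

lemma Wp_nonneg {p : ℝ} {μ ν : Measure (Euc 2)} : 0 ≤ Wp p μ ν := by
  refine Real.sInf_nonneg ?_
  rintro _ ⟨π, ⟨h1, h2⟩, rfl⟩
  positivity

lemma momNorm_le {p : ℝ} (hp : 1 ≤ p) {μ ν : Measure (Euc 2)} [IsProbabilityMeasure μ]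
    [IsProbabilityMeasure ν]
    (hμ : MemLp (fun x : Euc 2 => x) (ENNReal.ofReal p) μ)
    (hν : MemLp (fun x : Euc 2 => x) (ENNReal.ofReal p) ν) :
    momNorm p μ ≤ momNorm p ν + Wp p μ ν := by
  suffices momNorm p μ - momNorm p ν ≤ Wp p μ ν by linarith
  refine le_Wp fun π h1 h2 => ?_
  have H := cpl_of hp hμ hν h1 h2
  have h' : (fun z : Euc 2 × Euc 2 => z.1 - z.2) =
    ((fun z : Euc 2 × Euc 2 => z.1) - fun z : Euc 2 × Euc 2 => z.2) := rfl
  rw [H.cost, momNorm, momNorm, ← H.nf, ← H.ns, sub_le_iff_le_add, h',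
    ← ENNReal.toReal_add (H.f.sub H.s).2.ne H.s.2.ne]
  refine ENNReal.toReal_mono (ENNReal.add_ne_top.2 ⟨(H.f.sub H.s).2.ne, H.s.2.ne⟩) ?_
  have := eLpNorm_add_le (H.f.sub H.s).1 H.s.1 (p := ENNReal.ofReal p) (by simpa using hp)
  convert this using 2
  ext z : 1
  simp

lemma Wp_le {p : ℝ} (hp : 1 ≤ p) {μ ν : Measure (Euc 2)} [IsProbabilityMeasure μ]
    [IsProbabilityMeasure ν]
    (hμ : MemLp (fun x : Euc 2 => x) (ENNReal.ofReal p) μ)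
    (hν : MemLp (fun x : Euc 2 => x) (ENNReal.ofReal p) ν) :
    Wp p μ ν ≤ momNorm p μ + momNorm p ν := by
  have H := cpl_of hp hμ hν (π := μ.prod ν) (by simp) (by simp)
  have : Wp p μ ν ≤ (∫ z, dist z.1 z.2 ^ p ∂(μ.prod ν)) ^ (1 / p) := by
    refine csInf_le ⟨0, ?_⟩ ⟨μ.prod ν, ⟨by simp, by simp⟩, rfl⟩
    rintro _ ⟨π, ⟨h1, h2⟩, rfl⟩
    positivity
  refine this.trans ?_
  rw [H.cost, momNorm, momNorm, ← H.nf, ← H.ns,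
    ← ENNReal.toReal_add H.f.2.ne H.s.2.ne]
  refine ENNReal.toReal_mono (ENNReal.add_ne_top.2 ⟨H.f.2.ne, H.s.2.ne⟩) ?_
  exact eLpNorm_sub_le H.f.1 H.s.1 (p := ENNReal.ofReal p) (by simpa using hp)

lemma int_norm_le {p : ℝ} (hp : 1 ≤ p) {α : Type*} [MeasurableSpace α] {π : Measure α}
    [IsProbabilityMeasure π] {f : α → Euc 2} (hf : MemLp f (ENNReal.ofReal p) π) :
    ∫ z, ‖f z‖ ∂π ≤ (eLpNorm f (ENNReal.ofReal p) π).toReal := by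
  rw [integral_norm_eq_lintegral_enorm hf.1, ← eLpNorm_one_eq_lintegral_enorm]
  exact ENNReal.toReal_mono hf.2.ne
    (eLpNorm_le_eLpNorm_of_exponent_le (by simpa using hp) hf.1)

lemma key {F : Type*} [NormedAddCommGroup F] [NormedSpace ℝ F] [CompleteSpace F]
    {p : ℝ} (hp : 1 ≤ p) {μ ν : Measure (Euc 2)} [IsProbabilityMeasure μ]
    [IsProbabilityMeasure ν]
    (hμ : MemLp (fun x : Euc 2 => x) (ENNReal.ofReal p) μ)
    (hν : MemLp (fun x : Euc 2 => x) (ENNReal.ofReal p) ν)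
    {g h : Euc 2 → F} (hg : Integrable g μ) (hh : Integrable h ν) {a L : ℝ} (hL : 0 < L)
    (hgh : ∀ y z, ‖g y - h z‖ ≤ a + L * ‖y - z‖) :
    ‖∫ y, g y ∂μ - ∫ y, h y ∂ν‖ ≤ a + L * Wp p μ ν := by
  suffices (‖∫ y, g y ∂μ - ∫ y, h y ∂ν‖ - a) / L ≤ Wp p μ ν by
    rw [div_le_iff₀ hL] at this; linarith
  refine le_Wp fun π h1 h2 => ?_
  have H := cpl_of hp hμ hν h1 h2
  have := H.prob
  rw [H.cost, div_le_iff₀ hL]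
  have P1 : MeasurePreserving Prod.fst π μ := ⟨measurable_fst, h1⟩
  have P2 : MeasurePreserving Prod.snd π ν := ⟨measurable_snd, h2⟩
  have e1 : ∫ y, g y ∂μ = ∫ z, g z.1 ∂π := by
    rw [← h1, integral_map (by fun_prop) (by rw [h1]; exact hg.1)]
  have e2 : ∫ y, h y ∂ν = ∫ z, h z.2 ∂π := by
    rw [← h2, integral_map (by fun_prop) (by rw [h2]; exact hh.1)]
  have i1 : Integrable (fun z : Euc 2 × Euc 2 => g z.1) π := P1.integrable_comp_of_integrable hg
  have i2 : Integrable (fun z : Euc 2 × Euc 2 => h z.2) π := P2.integrable_comp_of_integrable hh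
  have i3 : Integrable (fun z : Euc 2 × Euc 2 => z.1 - z.2) π :=
    (H.f.sub H.s).integrable (by simpa using hp)
  rw [e1, e2, ← integral_sub i1 i2]
  have b1 : ‖∫ z, (g z.1 - h z.2) ∂π‖ ≤ ∫ z, (a + L * ‖z.1 - z.2‖) ∂π :=
    norm_integral_le_of_norm_le ((integrable_const a).add (i3.norm.const_mul L))
      (Eventually.of_forall fun z => hgh _ _)
  rw [integral_add (integrable_const a) (i3.norm.const_mul L), integral_const_mul] at b1
  simp only [integral_const, probReal_univ, one_smul] at b1
  have b2 := int_norm_le hp (H.f.sub H.s)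
  have b3 := mul_le_mul_of_nonneg_left b2 hL.le
  simp only [Pi.sub_apply] at b3
  rw [mul_comm _ L]
  have : (fun z : Euc 2 × Euc 2 => z.1 - z.2) = 
    ((fun z : Euc 2 × Euc 2 => z.1) - fun z : Euc 2 × Euc 2 => z.2) := rfl
  rw [this]
  linarith

lemma mom_bdd {p T : ℝ} (hp : 1 ≤ p) {μ : ℝ → Measure (Euc 2)} (h : IsPCurveOn p T μ) :
    ∃ B, ∀ s ∈ Set.Icc (0:ℝ) T, momNorm p (μ s) ≤ B := by
  obtain ⟨h1, h2, h3⟩ := h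
  have := isCompact_Icc (a := (0:ℝ)) (b := T) |>.induction_on
    (p := fun S => ∃ B, ∀ s ∈ S, s ∈ Set.Icc (0:ℝ) T → momNorm p (μ s) ≤ B) 
    ⟨0, by simp⟩ 
    (fun s t hst ⟨B, hB⟩ => ⟨B, fun x hx => hB x (hst hx)⟩) 
    (fun s t ⟨B, hB⟩ ⟨B', hB'⟩ => ⟨max B B', fun x hx hxI => hx.elim
      (fun hx => (hB x hx hxI).trans (le_max_left _ _))
      (fun hx => (hB' x hx hxI).trans (le_max_right _ _))⟩)
    (fun t ht => by
      obtain ⟨δ, hδ, H⟩ := h3 t ht 1 one_pos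
      refine ⟨Metric.ball t δ, mem_nhdsWithin_of_mem_nhds (Metric.ball_mem_nhds t hδ),
        momNorm p (μ t) + 1, fun s hs hsI => ?_⟩
      have := h1 s hsI
      have := h1 t ht
      have := momNorm_le hp (memLp_of_mom hp (h2 s hsI)) (memLp_of_mom hp (h2 t ht))
      have := H s hsI (by simpa [Real.dist_eq] using hs)
      linarith)
  obtain ⟨B, hB⟩ := this
  exact ⟨B, fun s hs => hB s hs hs⟩

lemma curve_meas {p T : ℝ} (hp : 1 ≤ p) {μ : ℝ → Measure (Euc 2)} (h : IsPCurveOn p T μ) :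
    Measurable (fun s : Set.Icc (0:ℝ) T => μ s) := by
  obtain ⟨h1, h2, h3⟩ := h
  have : ∀ s : Set.Icc (0:ℝ) T, IsProbabilityMeasure (μ s) := fun s => h1 s s.2
  refine Measurable.measure_of_isPiSystem_of_isProbabilityMeasure
    (S := {s : Set (Euc 2) | IsClosed s}) ?_ isPiSystem_isClosed ?_
  · rw [BorelSpace.measurable_eq (α := Euc 2), borel_eq_generateFrom_isClosed]
  intro F hF
  have pos : ∀ n : ℕ, 0 < 1 / ((n:ℝ) + 1) := fun n => by positivity
  refine measurable_of_tendsto_metrizable (f := fun (n : ℕ) (s : Set.Icc (0:ℝ) T) =>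
    ∫⁻ x, (thickenedIndicator (pos n) F x : ENNReal) ∂(μ s)) ?_ ?_
  · intro n
    have e : ∀ s : Set.Icc (0:ℝ) T, ∫⁻ x, (thickenedIndicator (pos n) F x : ENNReal) ∂(μ s) =
        ENNReal.ofReal (∫ x, (thickenedIndicator (pos n) F x : ℝ) ∂(μ s)) := fun s =>
      lintegral_coe_eq_integral _ (integrable_thickenedIndicator F (pos n))
    simp_rw [e]
    refine ENNReal.measurable_ofReal.comp (Continuous.measurable ?_)
    rw [Metric.continuous_iff]
    intro t ε hε
    set L : ℝ := n + 1 with hL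
    have Lpos : 0 < L := by positivity
    obtain ⟨δ, hδ, H⟩ := h3 t t.2 (ε / L) (by positivity)
    refine ⟨δ, hδ, fun s hs => ?_⟩
    have hW := H s s.2 (by simpa [Subtype.dist_eq, Real.dist_eq] using hs)
    have := key hp (memLp_of_mom hp (h2 s s.2)) (memLp_of_mom hp (h2 t t.2))
      (integrable_thickenedIndicator F (pos n)) (integrable_thickenedIndicator F (pos n))
      (a := 0) Lpos (fun y z => by
        have := (lipschitzWith_thickenedIndicator (pos n) F).dist_le_mul y z
        rw [NNReal.dist_eq, dist_eq_norm] at this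
        rw [Real.norm_eq_abs, zero_add]
        convert this using 2
        rw [NNReal.coe_inv, Real.coe_toNNReal _ (pos n).le]
        simp [hL])
    rw [dist_eq_norm]
    rw [lt_div_iff₀ Lpos] at hW
    linarith
  · rw [tendsto_pi_nhds]
    intro s
    exact tendsto_lintegral_thickenedIndicator_of_isClosed (μ s) hF pos
      tendsto_one_div_add_atTop_nhds_zero_nat

lemma K_int {p Cc : ℝ} (hp : 1 ≤ p) {μ : Measure (Euc 2)} [IsProbabilityMeasure μ]
    (hμ : MemLp (fun x : Euc 2 => x) (ENNReal.ofReal p) μ) {k : Euc 2 → Euc 2}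
    (hk : Measurable k) (hC : 0 < Cc) (hk0 : k 0 = 0) (hl : ∀ x y, ‖k x - k y‖ ≤ Cc * ‖x - y‖)
    (x : Euc 2) :
    Integrable (fun y => k (x - y)) μ ∧
      ‖∫ y, k (x - y) ∂μ‖ ≤ Cc * (‖x‖ + momNorm p μ) := by
  have hb : ∀ y, ‖k (x - y)‖ ≤ Cc * (‖x‖ + ‖y‖) := fun y => by
    have := hl (x - y) 0
    rw [hk0, sub_zero, sub_zero] at this
    exact this.trans (mul_le_mul_of_nonneg_left (norm_sub_le _ _) hC.le)
  have i0 : Integrable (fun y : Euc 2 => y) μ := hμ.integrable (by simpa using hp)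
  have i1 : Integrable (fun y : Euc 2 => Cc * (‖x‖ + ‖y‖)) μ :=
    ((integrable_const _).add i0.norm).const_mul _
  refine ⟨i1.mono' (hk.comp (measurable_const.sub measurable_id)).aestronglyMeasurable (Eventually.of_forall hb), ?_⟩
  refine (norm_integral_le_of_norm_le i1 (Eventually.of_forall hb)).trans ?_
  rw [integral_const_mul, integral_add (integrable_const _) i0.norm]
  simp only [integral_const, probReal_univ, one_smul]
  have := int_norm_le hp hμ
  rw [momNorm]
  gcongr

lemma drift_int {T lam χ Cc p : ℝ} (hT : 0 < T) (hlam : 0 < lam) (hχ : 0 < χ) (hC : 0 < Cc)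
    (hp : 1 ≤ p)
    {K : ℝ → Euc 2 → Euc 2}
    (hKmeas : Measurable (Function.uncurry K))
    (hK0 : ∀ t ∈ Set.Icc (0:ℝ) T, K t 0 = 0)
    (hKlip : ∀ t ∈ Set.Icc (0:ℝ) T, ∀ x y : Euc 2, ‖K t x - K t y‖ ≤ Cc * ‖x - y‖)
    {t : ℝ} (ht : t ∈ Set.Icc (0:ℝ) T) (x : Euc 2) {μ : ℝ → Measure (Euc 2)}
    (h : IsPCurveOn p T μ) :
    IntervalIntegrable (fun s => (χ * Real.exp (-lam * (t - s))) •
      (∫ y, K (t - s) (x - y) ∂(μ s))) volume 0 t := by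
  obtain ⟨B, hB⟩ := mom_bdd hp h
  let κ : ProbabilityTheory.Kernel ℝ (Euc 2) :=
    ⟨fun s => μ (Set.projIcc 0 T hT.le s), 
      (curve_meas hp h).comp continuous_projIcc.measurable⟩
  have hκ : ProbabilityTheory.IsMarkovKernel κ :=
    ⟨fun s => h.1 _ (Set.projIcc 0 T hT.le s).2⟩
  have hsm : StronglyMeasurable (fun s => ∫ y, K (t - s) (x - y) ∂(κ s)) := by
    refine StronglyMeasurable.integral_kernel_prod_right' (κ := κ)
      (f := fun q : ℝ × Euc 2 => K (t - q.1) (x - q.2)) ?_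
    refine Measurable.stronglyMeasurable ?_
    exact hKmeas.comp (f := fun q : ℝ × Euc 2 => (t - q.1, x - q.2)) (by fun_prop)
  have hm : AEStronglyMeasurable (fun s => (χ * Real.exp (-lam * (t - s))) •
      (∫ y, K (t - s) (x - y) ∂(μ s))) (volume.restrict (Set.Ioc 0 t)) := by
    refine AEStronglyMeasurable.smul
      (f := fun s : ℝ => χ * Real.exp (-lam * (t - s)))
      (Continuous.aestronglyMeasurable (by fun_prop)) ?_
    refine hsm.aestronglyMeasurable.congr ?_
    filter_upwards [ae_restrict_mem measurableSet_Ioc] with s hs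
    have : κ s = μ s := by
      change μ (Set.projIcc 0 T hT.le s) = μ s
      rw [Set.projIcc_of_mem hT.le ⟨hs.1.le, hs.2.trans ht.2⟩]
    rw [this]
  rw [intervalIntegrable_iff_integrableOn_Ioc_of_le ht.1]
  refine Integrable.mono' (integrable_const (χ * (Cc * (‖x‖ + B)))) hm ?_
  filter_upwards [ae_restrict_mem measurableSet_Ioc] with s hs
  have hsI : s ∈ Set.Icc (0:ℝ) T := ⟨hs.1.le, hs.2.trans ht.2⟩
  have htI : t - s ∈ Set.Icc (0:ℝ) T := ⟨by linarith [hs.2], by linarith [hs.1, ht.2]⟩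
  have := h.1 s hsI
  have b := (K_int hp (memLp_of_mom hp (h.2.1 s hsI)) (k := K (t - s))
    (hKmeas.comp (f := fun q => (t - s, q)) (by fun_prop)) hC (hK0 _ htI) (hKlip _ htI) x).2
  rw [norm_smul, Real.norm_of_nonneg (by positivity)]
  have e : Real.exp (-lam * (t - s)) ≤ 1 := by
    rw [Real.exp_le_one_iff]; nlinarith [htI.1]
  refine mul_le_mul (mul_le_of_le_one_right hχ.le e) (b.trans ?_) (norm_nonneg _) hχ.le
  have := hB s hsI
  gcongr

lemma exp_int {lam : ℝ} (hlam : 0 < lam) {t : ℝ} :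
    ∫ s in (0:ℝ)..t, Real.exp (-lam * (t - s)) ≤ 1 / lam := by
  have : ∀ s ∈ Set.uIcc 0 t, HasDerivAt (fun s => Real.exp (-lam * (t - s)) / lam)
      (Real.exp (-lam * (t - s))) s := fun s _ => by
    have := ((((hasDerivAt_id s).const_sub t).const_mul (-lam)).exp).div_const lam
    convert! this using 1
    simp
    field_simp
  rw [intervalIntegral.integral_eq_sub_of_hasDerivAt this
    (Continuous.intervalIntegrable (by fun_prop) _ _)]
  simp
  positivity

/-- If the kernel family `K` is measurable with `K_t(0) = 0` and `K_t` is `C`-Lipschitz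
for all `t ∈ [0,T]`, then the Keller–Segel drift `A` satisfies, for all `t ∈ [0,T]`,
`x₁, x₂ ∈ ℝ²` and measure curves `(μ_s),(ν_s) ∈ C([0,T],P_p(ℝ²))`:
`|A(t,x₁,(μ_s)) - A(t,x₂,(ν_s))| ≤ (χC/λ)( |x₁-x₂| + sup_{s∈[0,T]} W_p(μ_s,ν_s) )`. -/
theorem KSdrift_lipschitz
    (T lam χ Cc p : ℝ) (hT : 0 < T) (hlam : 0 < lam) (hχ : 0 < χ) (hC : 0 < Cc)
    (hp : 1 ≤ p)
    (K : ℝ → Euc 2 → Euc 2)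
    (hKmeas : Measurable (Function.uncurry K))
    (hK0 : ∀ t ∈ Set.Icc (0:ℝ) T, K t 0 = 0)
    (hKlip : ∀ t ∈ Set.Icc (0:ℝ) T, ∀ x y : Euc 2, ‖K t x - K t y‖ ≤ Cc * ‖x - y‖) :
    ∀ t ∈ Set.Icc (0:ℝ) T, ∀ x₁ x₂ : Euc 2, ∀ μ ν : ℝ → Measure (Euc 2),
      IsPCurveOn p T μ → IsPCurveOn p T ν →
      ‖KSdrift χ lam K t x₁ μ - KSdrift χ lam K t x₂ ν‖ ≤
        (χ * Cc / lam) *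
          (‖x₁ - x₂‖ + ⨆ s : Set.Icc (0:ℝ) T, Wp p (μ (s : ℝ)) (ν (s : ℝ))) := by
  intro t ht x₁ x₂ μ ν hμ hν
  set W := ⨆ s : Set.Icc (0:ℝ) T, Wp p (μ (s : ℝ)) (ν (s : ℝ)) with hW
  have hWle : ∀ s ∈ Set.Icc (0:ℝ) T, Wp p (μ s) (ν s) ≤ W := by
    obtain ⟨B, hB⟩ := mom_bdd hp hμ
    obtain ⟨B', hB'⟩ := mom_bdd hp hν
    intro s hs
    refine le_ciSup (f := fun s : Set.Icc (0:ℝ) T => Wp p (μ (s : ℝ)) (ν (s : ℝ)))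
      ⟨B + B', ?_⟩ ⟨s, hs⟩
    rintro _ ⟨s, rfl⟩
    have := hμ.1 s s.2
    have := hν.1 s s.2
    have := Wp_le hp (memLp_of_mom hp (hμ.2.1 s s.2)) (memLp_of_mom hp (hν.2.1 s s.2))
    have := hB s s.2
    have := hB' s s.2
    simp only
    linarith
  have hW0 : 0 ≤ W := Wp_nonneg.trans (hWle 0 ⟨le_rfl, hT.le⟩)
  rw [KSdrift, KSdrift, ← intervalIntegral.integral_sub
    (drift_int hT hlam hχ hC hp hKmeas hK0 hKlip ht x₁ hμ)
    (drift_int hT hlam hχ hC hp hKmeas hK0 hKlip ht x₂ hν)]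
  have step := intervalIntegral.norm_integral_le_of_norm_le (μ := volume) (a := 0) (b := t)
    (f := fun s => (χ * Real.exp (-lam * (t - s))) • (∫ y, K (t - s) (x₁ - y) ∂(μ s)) -
      (χ * Real.exp (-lam * (t - s))) • (∫ y, K (t - s) (x₂ - y) ∂(ν s)))
    (g := fun s => (χ * Cc * (‖x₁ - x₂‖ + W)) * Real.exp (-lam * (t - s))) ht.1
    (Eventually.of_forall fun s hs => ?_) (Continuous.intervalIntegrable (by fun_prop) _ _)
  · refine step.trans ?_
    rw [intervalIntegral.integral_const_mul]
    refine (mul_le_mul_of_nonneg_left (exp_int hlam) (by positivity)).trans (le_of_eq ?_)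
    ring
  · have hsI : s ∈ Set.Icc (0:ℝ) T := ⟨hs.1.le, hs.2.trans ht.2⟩
    have htI : t - s ∈ Set.Icc (0:ℝ) T := ⟨by linarith [hs.2], by linarith [hs.1, ht.2]⟩
    have := hμ.1 s hsI
    have := hν.1 s hsI
    have mμ := memLp_of_mom hp (hμ.2.1 s hsI)
    have mν := memLp_of_mom hp (hν.2.1 s hsI)
    have hk : Measurable (K (t - s)) := hKmeas.comp (f := fun q => (t - s, q)) (by fun_prop)
    have b := key hp mμ mν (K_int hp mμ hk hC (hK0 _ htI) (hKlip _ htI) x₁).1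
      (K_int hp mν hk hC (hK0 _ htI) (hKlip _ htI) x₂).1 (a := Cc * ‖x₁ - x₂‖) hC
      (fun y z => by
        refine (hKlip _ htI _ _).trans ?_
        rw [← mul_add]
        refine mul_le_mul_of_nonneg_left ?_ hC.le
        rw [show x₁ - y - (x₂ - z) = (x₁ - x₂) - (y - z) by abel]
        exact norm_sub_le _ _)
    rw [← smul_sub, norm_smul, Real.norm_of_nonneg (by positivity)]
    have b' : ‖∫ y, K (t - s) (x₁ - y) ∂(μ s) - ∫ y, K (t - s) (x₂ - y) ∂(ν s)‖ ≤
        Cc * (‖x₁ - x₂‖ + W) := by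
      have := mul_le_mul_of_nonneg_left (hWle s hsI) hC.le
      linarith
    refine (mul_le_mul_of_nonneg_left b' (by positivity)).trans (le_of_eq ?_)
    ring
end
end
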